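/- arXiv:2407.17806 — 2 statements merged into one kernel-verified Lean document; each statement's English description precedes it below -/
import Mathlib

section
/- For every L > 0 and T > 0 there exists a constant C > 0 (depending only on T and L) such that for all t ∈ (0,T] and all x, z ∈ [0,L], ∫₀ᵗ ∫₀ᴸ ( g(s, x, y) − g(s, z, y) )² dy ds ≤ C · |x − z|. -/
open MeasureTheory Real Set

/-- The one-dimensional heat kernel `p(t,x) = (4πt)^(−1/2) · exp(−x²/(4t))`. -/
noncomputable def heatKernel (t x : ℝ) : ℝ :=
  (Real.sqrt (4 * Real.pi * t))⁻¹ * Real.exp (-(x ^ 2) / (4 * t))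

/-- The Green's function of the heat equation on `[0,L]` with Neumann boundary
conditions. -/
noncomputable def greenNeumann (L t x y : ℝ) : ℝ :=
  ∑' n : ℤ, (heatKernel t (x - y - 2 * (n : ℝ) * L) + heatKernel t (x + y - 2 * (n : ℝ) * L))

theorem hasSum_cos_div_sq {x : ℝ} (hx : x ∈ Icc (0 : ℝ) 1) :
    HasSum (fun n : ℕ => cos (2 * π * (n + 1) * x) / ((n : ℝ) + 1) ^ 2)
      (π ^ 2 * (x ^ 2 - x + 6⁻¹)) := by
  have h := hasSum_one_div_nat_pow_mul_cos one_ne_zero hx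
  rw [← hasSum_nat_add_iff' 1] at h
  convert! h using 1
  · ext n
    push_cast
    ring
  · change _ = _ * bernoulliFun 2 x - _
    rw [bernoulliFun_two]
    norm_num [Nat.factorial]
    left
    ring

/-- The closed form of `∑ (cos kπu - cos kπv)² / k²`, from that of `∑ cos kθ / k²`. -/
theorem hasSum_sq_cos_sub_cos_div_sq {u v : ℝ} (hu : u ∈ Icc (0 : ℝ) 1) (hv : v ∈ Icc (0 : ℝ) 1) :
    HasSum (fun n : ℕ => (cos (π * (n + 1) * u) - cos (π * (n + 1) * v)) ^ 2 / ((n : ℝ) + 1) ^ 2)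
      (π ^ 2 * |u - v| / 2) := by
  wlog huv : v ≤ u generalizing u v
  · convert! this hv hu (le_of_not_ge huv) using 1
    · ext n
      ring
    · rw [abs_sub_comm]
  obtain ⟨hu0, hu1⟩ := hu
  obtain ⟨hv0, hv1⟩ := hv
  have h0 := hasSum_cos_div_sq (x := 0) (by simp)
  have h1 := hasSum_cos_div_sq (x := u) ⟨hu0, hu1⟩
  have h2 := hasSum_cos_div_sq (x := v) ⟨hv0, hv1⟩
  have h3 := hasSum_cos_div_sq (x := (u + v) / 2) ⟨by linarith, by linarith⟩
  have h4 := hasSum_cos_div_sq (x := (u - v) / 2) ⟨by linarith, by linarith⟩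
  convert! ((h0.add ((h1.add h2).div_const 2)).sub h3).sub h4 using 1
  · ext n
    rw [show 2 * π * ((n : ℝ) + 1) * u = 2 * (π * (n + 1) * u) by ring,
      show 2 * π * ((n : ℝ) + 1) * v = 2 * (π * (n + 1) * v) by ring,
      show 2 * π * ((n : ℝ) + 1) * ((u + v) / 2) = π * (n + 1) * u + π * (n + 1) * v by ring,
      show 2 * π * ((n : ℝ) + 1) * ((u - v) / 2) = π * (n + 1) * u - π * (n + 1) * v by ring,
      cos_two_mul, cos_two_mul, cos_add, cos_sub, mul_zero, cos_zero]
    ring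
  · rw [abs_of_nonneg (sub_nonneg.2 huv)]
    ring

/-- Poisson summation for the heat kernel on the circle of length `2L`. -/
theorem hasSum_heatKernel_sub_two_mul {L s : ℝ} (hL : 0 < L) (hs : 0 < s) (u : ℝ) :
    HasSum (fun n : ℤ => heatKernel s (u - 2 * (n : ℝ) * L))
      ((2 * L)⁻¹ * HurwitzZeta.cosKernel ((u / (2 * L) : ℝ) : UnitAddCircle)
        (π * s / L ^ 2)) := by
  have hτ : 0 < L ^ 2 / (π * s) := by positivity
  have h := (HurwitzZeta.hasSum_int_evenKernel (-(u / (2 * L))) hτ).mul_left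
    (√(4 * π * s))⁻¹
  rw [QuotientAddGroup.mk_neg, HurwitzZeta.evenKernel_neg,
    HurwitzZeta.evenKernel_functional_equation] at h
  convert! h using 1
  · ext n
    rw [heatKernel]
    congr 2
    field_simp
    ring
  · rw [one_div_div, ← mul_assoc]
    congr 1
    rw [← sqrt_eq_rpow, one_div, ← mul_inv, ← sqrt_mul (by positivity)]
    rw [show 4 * π * s * (L ^ 2 / (π * s)) = (2 * L) ^ 2 by field_simp; ring,
      sqrt_sq (by positivity)]

/-- The cosine expansion of the Neumann Green's function. -/
theorem hasSum_greenNeumann {L s : ℝ} (hL : 0 < L) (hs : 0 < s) (x y : ℝ) :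
    HasSum (fun n : ℕ => 2 / L * exp (-(π * (n + 1) / L) ^ 2 * s) * cos (π * (n + 1) * (x / L)) *
      cos (π * (n + 1) * (y / L))) (greenNeumann L s x y - 1 / L) := by
  have hτ : 0 < π * s / L ^ 2 := by positivity
  have hg : greenNeumann L s x y = _ :=
    ((hasSum_heatKernel_sub_two_mul hL hs (x - y)).add
      (hasSum_heatKernel_sub_two_mul hL hs (x + y))).tsum_eq
  have h := ((HurwitzZeta.hasSum_nat_cosKernel₀ ((x - y) / (2 * L)) hτ).add
    (HurwitzZeta.hasSum_nat_cosKernel₀ ((x + y) / (2 * L)) hτ)).mul_left (2 * L)⁻¹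
  rw [hg]
  convert! h using 1
  · ext n
    rw [show 2 * π * ((x - y) / (2 * L)) * ((n : ℝ) + 1)
        = π * (n + 1) * (x / L) - π * (n + 1) * (y / L) by field_simp,
      show 2 * π * ((x + y) / (2 * L)) * ((n : ℝ) + 1)
        = π * (n + 1) * (x / L) + π * (n + 1) * (y / L) by field_simp,
      show -π * ((n : ℝ) + 1) ^ 2 * (π * s / L ^ 2) = -(π * (n + 1) / L) ^ 2 * s by
        field_simp, cos_sub, cos_add]
    field_simp
    ring
  · field_simp
    ring

theorem integral_cos_int_mul {L : ℝ} (hL : 0 < L) (k : ℤ) :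
    ∫ y in (0 : ℝ)..L, cos (π * k * (y / L)) = if k = 0 then L else 0 := by
  split_ifs with hk
  · simp [hk]
  · have hc : π * k / L ≠ 0 := by
      have : (k : ℝ) ≠ 0 := mod_cast hk
      positivity
    simp_rw [show ∀ y : ℝ, π * k * (y / L) = π * k / L * y from fun y => by ring]
    rw [intervalIntegral.integral_comp_mul_left _ hc, integral_cos, div_mul_cancel₀ _ hL.ne',
      mul_comm π, sin_int_mul_pi]
    simp

theorem integral_cos_mul_cos_succ {L : ℝ} (hL : 0 < L) (m n : ℕ) :
    ∫ y in (0 : ℝ)..L, cos (π * (m + 1) * (y / L)) * cos (π * (n + 1) * (y / L)) =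
      if m = n then L / 2 else 0 := by
  have h (y : ℝ) : cos (π * (m + 1) * (y / L)) * cos (π * (n + 1) * (y / L)) =
      (cos (π * ((m - n : ℤ) : ℝ) * (y / L)) + cos (π * ((m + n + 2 : ℤ) : ℝ) * (y / L))) / 2 := by
    push_cast
    rw [show π * ((m : ℝ) - n) * (y / L) = π * (m + 1) * (y / L) - π * (n + 1) * (y / L) by ring,
      show π * ((m : ℝ) + n + 2) * (y / L) = π * (m + 1) * (y / L) + π * (n + 1) * (y / L) by ring,
      cos_sub, cos_add]
    ring
  simp_rw [h]
  rw [intervalIntegral.integral_div, intervalIntegral.integral_add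
    (by apply Continuous.intervalIntegrable; fun_prop)
    (by apply Continuous.intervalIntegrable; fun_prop), integral_cos_int_mul hL,
    integral_cos_int_mul hL, if_neg (show (m + n + 2 : ℤ) ≠ 0 by omega)]
  simp only [sub_eq_zero, Nat.cast_inj]
  split_ifs <;> simp

/-- Term-by-term integration of an absolutely convergent cosine series against a continuous
function. -/
theorem hasSum_integral_cos_series_mul {L : ℝ} {c : ℕ → ℝ} (hc : Summable fun n => |c n|)
    {h f : ℝ → ℝ} (hh : ∀ y, HasSum (fun n : ℕ => c n * cos (π * (n + 1) * (y / L))) (h y))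
    (hf : Continuous f) :
    HasSum (fun n : ℕ => c n * ∫ y in (0 : ℝ)..L, cos (π * (n + 1) * (y / L)) * f y)
      (∫ y in (0 : ℝ)..L, h y * f y) := by
  simp_rw [← intervalIntegral.integral_const_mul]
  refine intervalIntegral.hasSum_integral_of_dominated_convergence (fun n y => |c n| * |f y|)
    (fun n => ?_) (fun n => ?_) ?_ ?_ ?_
  · apply Continuous.aestronglyMeasurable
    fun_prop
  · refine .of_forall fun y _ => ?_
    rw [norm_eq_abs, abs_mul, abs_mul]
    gcongr
    exact mul_le_of_le_one_left (abs_nonneg _) (abs_cos_le_one _)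
  · exact .of_forall fun y _ => hc.mul_right _
  · simp_rw [tsum_mul_right]
    apply Continuous.intervalIntegrable
    fun_prop
  · refine .of_forall fun y _ => ?_
    simpa only [mul_assoc] using (hh y).mul_right (f y)

/-- Parseval's identity for absolutely convergent cosine series without constant term. -/
theorem hasSum_sq_integral_cos_series {L : ℝ} (hL : 0 < L) {c : ℕ → ℝ}
    (hc : Summable fun n => |c n|) {h : ℝ → ℝ}
    (hh : ∀ y, HasSum (fun n : ℕ => c n * cos (π * (n + 1) * (y / L))) (h y)) :
    HasSum (fun n : ℕ => L / 2 * c n ^ 2) (∫ y in (0 : ℝ)..L, h y ^ 2) := by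
  have hcont : Continuous h := by
    rw [show h = fun y => ∑' n : ℕ, c n * cos (π * (n + 1) * (y / L)) from
      funext fun y => (hh y).tsum_eq.symm]
    refine continuous_tsum (fun n => by fun_prop) hc fun n y => ?_
    rw [norm_eq_abs, abs_mul]
    exact mul_le_of_le_one_right (abs_nonneg _) (abs_cos_le_one _)
  have hcoef (n : ℕ) : ∫ y in (0 : ℝ)..L, cos (π * (n + 1) * (y / L)) * h y = L / 2 * c n := by
    have key := hasSum_integral_cos_series_mul (L := L) hc hh
      (f := fun y => cos (π * (n + 1) * (y / L))) (by fun_prop)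
    simp_rw [integral_cos_mul_cos_succ hL] at key
    simp_rw [mul_comm (cos _) (h _)]
    refine key.unique ?_
    convert! hasSum_ite_eq n (L / 2 * c n) using 2 with m
    split_ifs with hm
    · rw [hm, mul_comm]
    · simp
  have key := hasSum_integral_cos_series_mul (L := L) hc hh hcont
  simp_rw [hcoef] at key
  convert! key using 1
  · ext n
    ring
  · simp_rw [sq]

theorem summable_exp_neg_sq_mul {L s : ℝ} (hL : 0 < L) (hs : 0 < s) :
    Summable fun n : ℕ => exp (-(π * (n + 1) / L) ^ 2 * s) := by
  have h := (hasSum_greenNeumann hL hs 0 0).summable.mul_left (L / 2)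
  refine h.congr fun n => ?_
  simp
  field_simp

/-- The spatial `L²` increment of the Neumann Green's function at a fixed time. -/
theorem hasSum_integral_sq_greenNeumann_sub {L s : ℝ} (hL : 0 < L) (hs : 0 < s) (x z : ℝ) :
    HasSum (fun n : ℕ => 2 / L * (cos (π * (n + 1) * (x / L)) - cos (π * (n + 1) * (z / L))) ^ 2 *
        exp (-(2 * (π * (n + 1) / L) ^ 2) * s))
      (∫ y in (0 : ℝ)..L, (greenNeumann L s x y - greenNeumann L s z y) ^ 2) := by
  let c (n : ℕ) : ℝ := 2 / L * exp (-(π * (n + 1) / L) ^ 2 * s) *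
    (cos (π * (n + 1) * (x / L)) - cos (π * (n + 1) * (z / L)))
  have hc : Summable fun n => |c n| := by
    refine .of_nonneg_of_le (fun n => abs_nonneg _) (fun n => ?_)
      ((summable_exp_neg_sq_mul hL hs).mul_left (2 / L * 2))
    rw [abs_mul, abs_of_pos (by positivity), mul_right_comm (2 / L) 2]
    gcongr
    have h1 := abs_cos_le_one (π * (n + 1) * (x / L))
    have h2 := abs_cos_le_one (π * (n + 1) * (z / L))
    linarith [abs_sub (cos (π * (n + 1) * (x / L))) (cos (π * (n + 1) * (z / L)))]
  have hh (y : ℝ) : HasSum (fun n : ℕ => c n * cos (π * (n + 1) * (y / L)))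
      (greenNeumann L s x y - greenNeumann L s z y) := by
    convert! (hasSum_greenNeumann hL hs x y).sub (hasSum_greenNeumann hL hs z y) using 1
    · ext n
      simp only [c]
      ring
    · ring
  convert! hasSum_sq_integral_cos_series hL hc hh using 2 with n
  rw [show -(2 * (π * ((n : ℝ) + 1) / L) ^ 2) * s =
    -(π * (n + 1) / L) ^ 2 * s + -(π * (n + 1) / L) ^ 2 * s by ring, exp_add]
  simp only [c]
  field_simp

theorem integral_exp_neg_mul_le {a t : ℝ} (ha : 0 < a) (ht : 0 ≤ t) :
    ∫ s in Ioc 0 t, exp (-a * s) ≤ 1 / a := by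
  rw [← intervalIntegral.integral_of_le ht,
    intervalIntegral.integral_comp_mul_left _ (neg_ne_zero.2 ha.ne'), integral_exp, smul_eq_mul,
    mul_zero, exp_zero, inv_neg, neg_mul, ← mul_neg, neg_sub, one_div]
  exact mul_le_of_le_one_right (by positivity) (by linarith [exp_pos (-a * t)])

/-- For every `L > 0` and `T > 0` there is `C > 0` (depending only on `T` and `L`)
such that for all `t ∈ (0,T]` and `x, z ∈ [0,L]`,
`∫₀ᵗ ∫₀ᴸ (g(s,x,y) − g(s,z,y))² dy ds ≤ C · |x − z|`. -/
theorem greenNeumann_space_increment_L2 (L T : ℝ) (hL : 0 < L) (hT : 0 < T) :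
    ∃ C : ℝ, 0 < C ∧ ∀ t ∈ Set.Ioc (0 : ℝ) T, ∀ x ∈ Set.Icc (0 : ℝ) L, ∀ z ∈ Set.Icc (0 : ℝ) L,
      ∫ s in Set.Ioc (0 : ℝ) t, ∫ y in Set.Ioc (0 : ℝ) L,
          (greenNeumann L s x y - greenNeumann L s z y) ^ 2
        ≤ C * |x - z| := by
  refine ⟨1 / 2, by norm_num, fun t ht x hx z hz => ?_⟩
  have hmem {w : ℝ} (hw : w ∈ Icc 0 L) : w / L ∈ Icc (0 : ℝ) 1 :=
    ⟨div_nonneg hw.1 hL.le, div_le_one_of_le₀ hw.2 hL.le⟩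
  let F (n : ℕ) (s : ℝ) : ℝ :=
    2 / L * (cos (π * (n + 1) * (x / L)) - cos (π * (n + 1) * (z / L))) ^ 2 *
      exp (-(2 * (π * (n + 1) / L) ^ 2) * s)
  have hF (n : ℕ) : Integrable (F n) (volume.restrict (Ioc 0 t)) := by
    apply Continuous.integrableOn_Ioc
    fun_prop
  have hle (n : ℕ) : ∫ s in Ioc 0 t, F n s ≤ L / π ^ 2 *
      ((cos (π * (n + 1) * (x / L)) - cos (π * (n + 1) * (z / L))) ^ 2 / ((n : ℝ) + 1) ^ 2) := by
    have ha : 0 < 2 * (π * ((n : ℝ) + 1) / L) ^ 2 := by positivity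
    simp only [F]
    rw [integral_const_mul]
    refine (mul_le_mul_of_nonneg_left (integral_exp_neg_mul_le ha ht.1.le)
      (by positivity)).trans_eq ?_
    field_simp
  have hsum := (hasSum_sq_cos_sub_cos_div_sq (hmem hx) (hmem hz)).mul_left (L / π ^ 2)
  have hnorm (n : ℕ) (s : ℝ) : ‖F n s‖ = F n s := norm_of_nonneg (by positivity)
  have hint : HasSum (fun n => ∫ s in Ioc 0 t, F n s) (∫ s in Ioc 0 t, ∑' n, F n s) := by
    refine hasSum_integral_of_summable_integral_norm hF ?_
    simp_rw [hnorm]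
    exact .of_nonneg_of_le (fun n => integral_nonneg fun s => by positivity) hle hsum.summable
  calc _ = ∫ s in Ioc 0 t, ∑' n, F n s := setIntegral_congr_fun measurableSet_Ioc fun s hs => by
        rw [(hasSum_integral_sq_greenNeumann_sub hL hs.1 x z).tsum_eq,
          intervalIntegral.integral_of_le hL.le]
    _ ≤ L / π ^ 2 * (π ^ 2 * |x / L - z / L| / 2) := hasSum_le hle hint hsum
    _ = 1 / 2 * |x - z| := by
        rw [← sub_div, abs_div, abs_of_pos hL]
        field_simp
end

section
/- For every L > 0 and T > 0 there exists a constant C > 0 (depending only on T and L) such that for all 0 ≤ s ≤ t ≤ T and all x ∈ [0,L], ∫₀ˢ ∫₀ᴸ ( g(t − r, x, y) − g(s − r, x, y) )² dy dr + ∫ₛᵗ ∫₀ᴸ g(t − r, x, y)² dy dr ≤ C · (t − s)^{1/2}. -/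
open MeasureTheory Real Set

/-- The cosine mode `cos (kπy/L)`, a Neumann eigenfunction of the Laplacian on `[0,L]`. -/
noncomputable def neumannMode (L : ℝ) (k : ℤ) (y : ℝ) : ℝ := Real.cos (k * π * y / L)

/-- The Neumann eigenvalue `(kπ/L)²`. -/
noncomputable def neumannEigenvalue (L : ℝ) (k : ℤ) : ℝ := (k * π / L) ^ 2

lemma abs_neumannMode_le_one (L : ℝ) (k : ℤ) (y : ℝ) : |neumannMode L k y| ≤ 1 :=
  Real.abs_cos_le_one _

lemma neumannMode_neg (L : ℝ) (k : ℤ) (y : ℝ) : neumannMode L (-k) y = neumannMode L k y := by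
  simp only [neumannMode, ← Real.cos_neg (k * π * y / L)]
  push_cast
  ring_nf

lemma neumannEigenvalue_neg (L : ℝ) (k : ℤ) :
    neumannEigenvalue L (-k) = neumannEigenvalue L k := by
  simp only [neumannEigenvalue]
  push_cast
  ring

lemma neumannEigenvalue_nonneg (L : ℝ) (k : ℤ) : 0 ≤ neumannEigenvalue L k := sq_nonneg _

@[fun_prop]
lemma continuous_neumannMode (L : ℝ) (k : ℤ) : Continuous (neumannMode L k) := by
  unfold neumannMode
  fun_prop

lemma neumannMode_mul (L : ℝ) (k l : ℤ) (y : ℝ) :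
    neumannMode L k y * neumannMode L l y
      = (neumannMode L (l - k) y + neumannMode L (l + k) y) / 2 := by
  have h1 : ((l : ℝ) - k) * π * y / L = l * π * y / L - k * π * y / L := by ring
  have h2 : ((l : ℝ) + k) * π * y / L = l * π * y / L + k * π * y / L := by ring
  simp only [neumannMode]
  push_cast
  rw [h1, h2, Real.cos_sub, Real.cos_add]
  ring

lemma integral_neumannMode {L : ℝ} (hL : 0 < L) (m : ℤ) :
    ∫ y in (0 : ℝ)..L, neumannMode L m y = if m = 0 then L else 0 := by
  split_ifs with hm
  · simp [neumannMode, hm]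
  · have hc : (m * π / L : ℝ) ≠ 0 := by
      have := Real.pi_pos.ne'
      have : (m : ℝ) ≠ 0 := by exact_mod_cast hm
      positivity
    have h : ∀ y, neumannMode L m y = Real.cos (m * π / L * y) := fun y ↦ by
      simp only [neumannMode]
      ring_nf
    simp only [h]
    rw [intervalIntegral.integral_comp_mul_left (fun y ↦ Real.cos y) hc, integral_cos]
    have : m * π / L * L = m * π := by field_simp
    simp [this, Real.sin_int_mul_pi]

lemma integral_neumannMode_mul {L : ℝ} (hL : 0 < L) (k l : ℤ) :
    ∫ y in (0 : ℝ)..L, neumannMode L k y * neumannMode L l y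
      = (if l = k then L / 2 else 0) + (if l = -k then L / 2 else 0) := by
  simp only [neumannMode_mul]
  rw [intervalIntegral.integral_div, intervalIntegral.integral_add
    ((continuous_neumannMode _ _).intervalIntegrable _ _)
    ((continuous_neumannMode _ _).intervalIntegrable _ _),
    integral_neumannMode hL, integral_neumannMode hL]
  simp only [sub_eq_zero, ← eq_neg_iff_add_eq_zero, add_div, ite_div, zero_div]

/-- A cosine series with summable coefficients may be integrated term by term against a
bounded continuous function. -/
lemma hasSum_integral_cosine_series_mul {L : ℝ} {w : ℤ → ℝ} (hw : Summable fun k ↦ |w k|)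
    {f g : ℝ → ℝ} (hf : ∀ y, HasSum (fun k ↦ w k * neumannMode L k y) (f y))
    (hg : Continuous g) {M : ℝ} (hM : ∀ y, |g y| ≤ M) :
    HasSum (fun k ↦ w k * ∫ y in (0 : ℝ)..L, neumannMode L k y * g y)
      (∫ y in (0 : ℝ)..L, f y * g y) := by
  have := intervalIntegral.hasSum_integral_of_dominated_convergence (μ := volume)
    (a := 0) (b := L) (F := fun k y ↦ w k * (neumannMode L k y * g y))
    (f := fun y ↦ f y * g y) (fun k _ ↦ |w k| * M)
    (fun k ↦ Continuous.aestronglyMeasurable (by fun_prop))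
    (fun k ↦ .of_forall fun y _ ↦ ?_)
    (.of_forall fun y _ ↦ hw.mul_right M)
    intervalIntegrable_const
    (.of_forall fun y _ ↦ ?_)
  · simpa only [intervalIntegral.integral_const_mul] using this
  · rw [Real.norm_eq_abs, abs_mul, abs_mul]
    refine mul_le_mul_of_nonneg_left ?_ (abs_nonneg _)
    calc _ ≤ 1 * |g y| := by gcongr; exact abs_neumannMode_le_one L k y
      _ ≤ M := by simpa using hM y
  · simpa only [mul_assoc] using (hf y).mul_right (g y)

/-- Parseval's identity for even cosine series. -/
lemma hasSum_integral_sq_cosine_series {L : ℝ} (hL : 0 < L) {w : ℤ → ℝ}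
    (hw : Summable fun k ↦ |w k|) (heven : ∀ k, w (-k) = w k) {f : ℝ → ℝ}
    (hf : ∀ y, HasSum (fun k ↦ w k * neumannMode L k y) (f y)) :
    HasSum (fun k ↦ L * w k ^ 2) (∫ y in (0 : ℝ)..L, f y ^ 2) := by
  have hterm : ∀ k y, |w k * neumannMode L k y| ≤ |w k| := fun k y ↦ by
    rw [abs_mul]
    exact mul_le_of_le_one_right (abs_nonneg _) (abs_neumannMode_le_one L k y)
  have hf_eq : f = fun y ↦ ∑' k, w k * neumannMode L k y := funext fun y ↦ (hf y).tsum_eq.symm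
  have hcont : Continuous f := by
    rw [hf_eq]
    exact continuous_tsum (fun k ↦ by fun_prop) hw hterm
  have hbound : ∀ y, |f y| ≤ ∑' k, |w k| := fun y ↦ by
    rw [← (hf y).tsum_eq]
    exact tsum_of_norm_bounded (f := fun k ↦ w k * neumannMode L k y) hw.hasSum fun k ↦ hterm k y
  have hcoeff : ∀ k, ∫ y in (0 : ℝ)..L, neumannMode L k y * f y = L * w k := fun k ↦ by
    have h1 := hasSum_integral_cosine_series_mul hw hf (continuous_neumannMode L k)
      (abs_neumannMode_le_one L k)
    have h2 : HasSum (fun l ↦ w l * ∫ y in (0 : ℝ)..L, neumannMode L l y * neumannMode L k y)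
        (w k * (L / 2) + w (-k) * (L / 2)) := by
      convert (hasSum_ite_eq k (w k * (L / 2))).add (hasSum_ite_eq (-k) (w (-k) * (L / 2)))
        using 2 with l
      simp only [mul_comm (neumannMode L l _)]
      rw [integral_neumannMode_mul hL, mul_add]
      congr 1 <;> split_ifs with h <;> simp [h]
    simp only [mul_comm (neumannMode L k _)]
    rw [h1.unique h2, heven]
    ring
  have h := hasSum_integral_cosine_series_mul hw hf hcont hbound
  simp only [hcoeff, ← sq] at h
  convert h using 2 with k
  ring

/-- Poisson summation for the periodized heat kernel. -/
lemma exists_hasSum_heatKernel_translates {L t : ℝ} (hL : 0 < L) (ht : 0 < t) (w : ℝ) :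
    ∃ S, HasSum (fun n : ℤ ↦ heatKernel t (w - 2 * (n : ℝ) * L)) S ∧
      HasSum (fun k : ℤ ↦ (2 * L)⁻¹ * Real.exp (-neumannEigenvalue L k * t) * neumannMode L k w)
        S := by
  set a : ℝ := -w / (2 * L) with ha
  set τ : ℝ := L ^ 2 / (π * t) with hτ
  have hτ0 : 0 < τ := by positivity
  have h1 := (HurwitzZeta.hasSum_int_evenKernel a hτ0).mul_left (Real.sqrt (4 * π * t))⁻¹
  have h2 := Complex.hasSum_re (HurwitzZeta.hasSum_int_cosKernel a (one_div_pos.mpr hτ0))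
  refine ⟨(Real.sqrt (4 * π * t))⁻¹ * HurwitzZeta.evenKernel a τ, ?_, ?_⟩
  · refine h1.congr_fun fun n ↦ ?_
    simp only [heatKernel]
    congr 2
    rw [ha, hτ]
    field_simp
    ring
  · rw [HurwitzZeta.evenKernel_functional_equation]
    have hsqrt : (Real.sqrt (4 * π * t))⁻¹ * (1 / τ ^ (1 / 2 : ℝ)) = (2 * L)⁻¹ := by
      rw [← Real.sqrt_eq_rpow, hτ, one_div, ← mul_inv, ← Real.sqrt_mul (by positivity)]
      congr 1
      rw [show 4 * π * t * (L ^ 2 / (π * t)) = (2 * L) ^ 2 by field_simp; ring]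
      exact Real.sqrt_sq (by positivity)
    rw [← mul_assoc, hsqrt]
    simp only [mul_assoc]
    refine HasSum.mul_left _ ?_
    refine h2.congr_fun fun k ↦ ?_
    rw [Complex.re_mul_ofReal, mul_comm]
    congr 1
    · rw [show (2 * π * Complex.I * a * k : ℂ) = ((2 * π * a * k : ℝ) : ℂ) * Complex.I by
        push_cast; ring, Complex.exp_ofReal_mul_I_re, neumannMode, ← Real.cos_neg]
      congr 1
      rw [ha]
      field_simp
    · congr 1
      rw [neumannEigenvalue, hτ]
      field_simp

/-- The spectral decomposition of the Neumann Green's function. -/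
lemma hasSum_greenNeumann_s10 {L t : ℝ} (hL : 0 < L) (ht : 0 < t) (x y : ℝ) :
    HasSum (fun k : ℤ ↦ L⁻¹ * Real.exp (-neumannEigenvalue L k * t) * neumannMode L k x
      * neumannMode L k y) (greenNeumann L t x y) := by
  obtain ⟨S₁, h1, h1'⟩ := exists_hasSum_heatKernel_translates hL ht (x - y)
  obtain ⟨S₂, h2, h2'⟩ := exists_hasSum_heatKernel_translates hL ht (x + y)
  have : greenNeumann L t x y = S₁ + S₂ := (h1.add h2).tsum_eq
  rw [this]
  convert h1'.add h2' using 2 with k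
  simp only [neumannMode, mul_sub, mul_add, sub_div, add_div, Real.cos_sub, Real.cos_add]
  field_simp
  ring

lemma summable_exp_neumannEigenvalue {L t : ℝ} (hL : 0 < L) (ht : 0 < t) :
    Summable fun k : ℤ ↦ Real.exp (-neumannEigenvalue L k * t) := by
  obtain ⟨S, -, h⟩ := exists_hasSum_heatKernel_translates hL ht 0
  have := h.summable.mul_left (2 * L)
  refine this.congr fun k ↦ ?_
  simp only [neumannMode, mul_zero, zero_div, Real.cos_zero]
  field_simp

lemma hasSum_integral_greenNeumann_sq {L t : ℝ} (hL : 0 < L) (ht : 0 < t) (x : ℝ) :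
    HasSum (fun k : ℤ ↦ L⁻¹ * neumannMode L k x ^ 2
        * Real.exp (-neumannEigenvalue L k * t) ^ 2)
      (∫ y in Set.Ioc (0 : ℝ) L, greenNeumann L t x y ^ 2) := by
  rw [← intervalIntegral.integral_of_le hL.le]
  convert hasSum_integral_sq_cosine_series hL
    (w := fun k ↦ L⁻¹ * Real.exp (-neumannEigenvalue L k * t) * neumannMode L k x) ?_ ?_
    (hasSum_greenNeumann_s10 hL ht x) using 2 with k
  · field_simp
  · refine Summable.of_nonneg_of_le (fun _ ↦ abs_nonneg _) (fun k ↦ ?_)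
      ((summable_exp_neumannEigenvalue hL ht).mul_left L⁻¹)
    rw [abs_mul, abs_of_pos (by positivity : 0 < L⁻¹ * _)]
    exact mul_le_of_le_one_right (by positivity) (abs_neumannMode_le_one L k x)
  · intro k
    rw [neumannEigenvalue_neg, neumannMode_neg]

lemma hasSum_integral_greenNeumann_sub_sq {L t u : ℝ} (hL : 0 < L) (ht : 0 < t) (hu : 0 < u)
    (x : ℝ) :
    HasSum (fun k : ℤ ↦ L⁻¹ * neumannMode L k x ^ 2
        * (Real.exp (-neumannEigenvalue L k * t) - Real.exp (-neumannEigenvalue L k * u)) ^ 2)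
      (∫ y in Set.Ioc (0 : ℝ) L, (greenNeumann L t x y - greenNeumann L u x y) ^ 2) := by
  rw [← intervalIntegral.integral_of_le hL.le]
  convert hasSum_integral_sq_cosine_series hL
    (w := fun k ↦ L⁻¹ * (Real.exp (-neumannEigenvalue L k * t)
      - Real.exp (-neumannEigenvalue L k * u)) * neumannMode L k x) ?_ ?_
    (fun y ↦ ?_) using 2 with k
  · field_simp
  · refine Summable.of_nonneg_of_le (fun _ ↦ abs_nonneg _) (fun k ↦ ?_)
      (((summable_exp_neumannEigenvalue hL ht).add
        (summable_exp_neumannEigenvalue hL hu)).mul_left L⁻¹)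
    rw [abs_mul, abs_mul, abs_of_pos (inv_pos.mpr hL)]
    refine (mul_le_of_le_one_right (by positivity) (abs_neumannMode_le_one L k x)).trans ?_
    gcongr
    exact (abs_sub _ _).trans_eq (by rw [abs_of_pos (Real.exp_pos _), abs_of_pos (Real.exp_pos _)])
  · intro k
    rw [neumannEigenvalue_neg, neumannMode_neg]
  · refine HasSum.congr_fun
      ((hasSum_greenNeumann_s10 hL ht x y).sub (hasSum_greenNeumann_s10 hL hu x y)) fun k ↦ ?_
    ring

/-- Integrating a series of nonnegative continuous functions whose integrals are dominated
by a convergent series. -/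
lemma setIntegral_le_of_hasSum {ι : Type*} [Countable ι] {F : ι → ℝ → ℝ} {Φ : ℝ → ℝ} {a b S : ℝ}
    {B : ι → ℝ}
    (hF : ∀ k, Continuous (F k)) (hF0 : ∀ k r, 0 ≤ F k r)
    (hΦ : ∀ r, r < b → HasSum (fun k ↦ F k r) (Φ r))
    (hB : ∀ k, ∫ r in Set.Ioc a b, F k r ≤ B k) (hS : HasSum B S) :
    ∫ r in Set.Ioc a b, Φ r ≤ S := by
  have h0 : ∀ k, 0 ≤ ∫ r in Set.Ioc a b, F k r := fun k ↦ integral_nonneg (hF0 k)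
  have h := hasSum_integral_of_summable_integral_norm (μ := volume.restrict (Set.Ioc a b)) (F := F)
    (fun k ↦ (hF k).integrableOn_Ioc)
    (by
      simp only [Real.norm_of_nonneg (hF0 _ _)]
      exact Summable.of_nonneg_of_le h0 hB hS.summable)
  have hΦ' : ∫ r in Set.Ioc a b, Φ r = ∫ r in Set.Ioc a b, ∑' k, F k r := by
    rw [integral_Ioc_eq_integral_Ioo, integral_Ioc_eq_integral_Ioo]
    exact setIntegral_congr_fun measurableSet_Ioo fun r hr ↦ (hΦ r hr.2).tsum_eq.symm
  rw [hΦ']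
  exact hasSum_le hB h hS

lemma integral_exp_sq_le {lam a b : ℝ} (hlam : 0 ≤ lam) (hab : a ≤ b) :
    ∫ r in Set.Ioc a b, Real.exp (-lam * (b - r)) ^ 2 ≤ b - a := by
  rw [← intervalIntegral.integral_of_le hab]
  have h := intervalIntegral.integral_mono_on (μ := volume) hab
    (f := fun r ↦ Real.exp (-lam * (b - r)) ^ 2) (g := fun _ ↦ 1)
    (Continuous.intervalIntegrable (by fun_prop) _ _) intervalIntegrable_const fun r hr ↦ by
      refine pow_le_one₀ (Real.exp_pos _).le (Real.exp_le_one_iff.mpr ?_)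
      nlinarith [mul_nonneg hlam (sub_nonneg.mpr hr.2)]
  simpa using h

lemma mul_integral_exp_sq_le {lam a b : ℝ} (hab : a ≤ b) :
    lam * ∫ r in Set.Ioc a b, Real.exp (-lam * (b - r)) ^ 2 ≤ 1 := by
  rw [← intervalIntegral.integral_of_le hab]
  have h : ∀ r ∈ Set.uIcc a b, HasDerivAt (fun r ↦ Real.exp (-lam * (b - r)) ^ 2 / 2)
      (lam * Real.exp (-lam * (b - r)) ^ 2) r := fun r _ ↦ by
    have := ((((hasDerivAt_id r).const_sub b).const_mul (-lam)).exp.pow 2).div_const 2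
    refine this.congr_deriv ?_
    norm_num
    ring
  rw [← intervalIntegral.integral_const_mul,
    intervalIntegral.integral_eq_sub_of_hasDerivAt h (Continuous.intervalIntegrable (by fun_prop) _ _)]
  simp only [sub_self, mul_zero, Real.exp_zero]
  nlinarith [sq_nonneg (Real.exp (-lam * (b - a)))]

lemma integral_exp_sub_sq {lam a s t : ℝ} :
    ∫ r in Set.Ioc a s, (Real.exp (-lam * (t - r)) - Real.exp (-lam * (s - r))) ^ 2
      = (1 - Real.exp (-lam * (t - s))) ^ 2
        * ∫ r in Set.Ioc a s, Real.exp (-lam * (s - r)) ^ 2 := by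
  rw [← integral_const_mul]
  congr 1 with r
  rw [show -lam * (t - r) = -lam * (t - s) + -lam * (s - r) by ring, Real.exp_add]
  ring

lemma integral_exp_sub_sq_le {lam a s t : ℝ} (hlam : 0 ≤ lam) (has : a ≤ s) (hst : s ≤ t) :
    (∫ r in Set.Ioc a s, (Real.exp (-lam * (t - r)) - Real.exp (-lam * (s - r))) ^ 2 ≤ t - s) ∧
    lam * ∫ r in Set.Ioc a s, (Real.exp (-lam * (t - r)) - Real.exp (-lam * (s - r))) ^ 2 ≤ 1 := by
  rw [integral_exp_sub_sq]
  have hJ0 : 0 ≤ ∫ r in Set.Ioc a s, Real.exp (-lam * (s - r)) ^ 2 :=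
    integral_nonneg fun r ↦ by positivity
  have hJ := mul_integral_exp_sq_le (lam := lam) has
  set J := ∫ r in Set.Ioc a s, Real.exp (-lam * (s - r)) ^ 2
  have hmul : 0 ≤ lam * (t - s) := mul_nonneg hlam (sub_nonneg.mpr hst)
  have he1 : Real.exp (-lam * (t - s)) ≤ 1 := Real.exp_le_one_iff.mpr (by linarith)
  have he0 := Real.exp_pos (-lam * (t - s))
  have he2 := Real.add_one_le_exp (-lam * (t - s))
  set e := Real.exp (-lam * (t - s))
  have hsq1 : (1 - e) ^ 2 ≤ 1 := by nlinarith
  have hsq2 : (1 - e) ^ 2 ≤ lam * (t - s) := by nlinarith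
  constructor
  · nlinarith [mul_le_mul_of_nonneg_right hsq2 hJ0,
      mul_le_mul_of_nonneg_right hJ (sub_nonneg.mpr hst)]
  · nlinarith [mul_le_mul_of_nonneg_right hsq1 (mul_nonneg hlam hJ0)]

lemma hasSum_inv_sq_nat_le {c : ℝ} (hc : 0 < c) :
    ∃ S ≤ c⁻¹, HasSum (fun n : ℕ ↦ ((1 + c * (n + 1)) ^ 2)⁻¹) S := by
  have hle : ∀ n : ℕ, ((1 + c * (n + 1)) ^ 2)⁻¹
      ≤ c⁻¹ * ((1 + c * n)⁻¹ - (1 + c * ((n + 1 : ℕ) : ℝ))⁻¹) := fun n ↦ by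
    have h1 : 0 < 1 + c * (n : ℝ) := by positivity
    have h2 : 0 < 1 + c * ((n : ℝ) + 1) := by positivity
    have : c⁻¹ * ((1 + c * n)⁻¹ - (1 + c * ((n + 1 : ℕ) : ℝ))⁻¹)
        = ((1 + c * n) * (1 + c * (n + 1)))⁻¹ := by
      push_cast
      field_simp
      ring
    rw [this]
    gcongr
    nlinarith
  have hpart : ∀ N : ℕ, ∑ n ∈ Finset.range N, ((1 + c * ((n : ℝ) + 1)) ^ 2)⁻¹ ≤ c⁻¹ := fun N ↦ by
    refine (Finset.sum_le_sum fun n _ ↦ hle n).trans ?_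
    rw [← Finset.mul_sum, Finset.sum_range_sub' (fun n : ℕ ↦ (1 + c * (n : ℝ))⁻¹)]
    refine mul_le_of_le_one_right (by positivity) ?_
    have : 0 ≤ (1 + c * (N : ℝ))⁻¹ := by positivity
    simpa using this
  have hsum := summable_of_sum_range_le (fun n ↦ by positivity) hpart
  exact ⟨_, hsum.tsum_le_of_sum_range_le hpart, hsum.hasSum⟩

lemma hasSum_inv_sq_int_le {c : ℝ} (hc : 0 < c) :
    ∃ S ≤ 1 + 2 * c⁻¹, HasSum (fun k : ℤ ↦ ((1 + c * |(k : ℝ)|) ^ 2)⁻¹) S := by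
  obtain ⟨S, hS, h⟩ := hasSum_inv_sq_nat_le hc
  refine ⟨1 + S + S, by linarith, ?_⟩
  refine HasSum.of_nat_of_neg_add_one ?_ ?_
  · rw [add_comm]
    rw [← hasSum_nat_add_iff' 1]
    simpa [abs_of_nonneg, add_nonneg] using h
  · convert h using 5 with n
    push_cast
    rw [abs_neg, abs_of_nonneg (by positivity)]

lemma le_mul_inv_one_add_sq {q h lam u : ℝ} (hh : 0 ≤ h) (hu0 : 0 ≤ u) (hu : u ^ 2 = h * lam)
    (hq : q ≤ h) (hlq : lam * q ≤ 1) (hq0 : 0 ≤ q) : q ≤ 4 * h * ((1 + u) ^ 2)⁻¹ := by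
  rw [← div_eq_mul_inv, le_div_iff₀ (by positivity)]
  calc q * (1 + u) ^ 2 ≤ q * (2 * (1 + u ^ 2)) := by gcongr; nlinarith [sq_nonneg (1 - u)]
    _ = 2 * q + 2 * h * (lam * q) := by rw [hu]; ring
    _ ≤ 2 * h + 2 * h * 1 := by gcongr
    _ = 4 * h := by ring

/-- The dominating series for the Fourier coefficients of a time increment `h`. -/
lemma exists_hasSum_majorant_le {L T h : ℝ} (hL : 0 < L) (hh : 0 < h) (hhT : h ≤ T) :
    ∃ S ≤ (4 * Real.sqrt T + 8 * L / π) * Real.sqrt h,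
      HasSum (fun k : ℤ ↦ 4 * h * ((1 + Real.sqrt h * π / L * |(k : ℝ)|) ^ 2)⁻¹) S := by
  have hsq : 0 < Real.sqrt h := Real.sqrt_pos.mpr hh
  obtain ⟨S, hS, hsum⟩ := hasSum_inv_sq_int_le (c := Real.sqrt h * π / L) (by positivity)
  refine ⟨4 * h * S, ?_, hsum.mul_left _⟩
  calc 4 * h * S ≤ 4 * h * (1 + 2 * (Real.sqrt h * π / L)⁻¹) := by gcongr
    _ = (4 * Real.sqrt h + 8 * L / π) * Real.sqrt h := by
      nth_rewrite 1 [← Real.mul_self_sqrt hh.le]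
      field_simp
      ring
    _ ≤ _ := by gcongr

lemma const_mul_le_majorant {L h q : ℝ} (hL : 0 < L) (hh : 0 ≤ h) (k : ℤ) (x : ℝ) (hq : q ≤ h)
    (hlq : neumannEigenvalue L k * q ≤ 1) (hq0 : 0 ≤ q) :
    L⁻¹ * neumannMode L k x ^ 2 * q
      ≤ L⁻¹ * (4 * h * ((1 + Real.sqrt h * π / L * |(k : ℝ)|) ^ 2)⁻¹) := by
  rw [mul_assoc]
  refine mul_le_mul_of_nonneg_left ?_ (inv_pos.mpr hL).le
  refine (mul_le_of_le_one_left hq0 ?_).trans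
    (le_mul_inv_one_add_sq hh (by positivity) ?_ hq hlq hq0)
  · exact (sq_le_one_iff_abs_le_one _).mpr (abs_neumannMode_le_one L k x)
  · rw [neumannEigenvalue, mul_pow, sq_abs, div_pow, mul_pow, Real.sq_sqrt hh]
    ring

/-- For every `L > 0` and `T > 0` there is `C > 0` (depending only on `T` and `L`)
such that for all `0 ≤ s ≤ t ≤ T` and `x ∈ [0,L]`,
`∫₀ˢ ∫₀ᴸ (g(t−r,x,y) − g(s−r,x,y))² dy dr + ∫ₛᵗ ∫₀ᴸ g(t−r,x,y)² dy dr ≤ C (t−s)^{1/2}`. -/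
theorem greenNeumann_time_increment_L2 (L T : ℝ) (hL : 0 < L) (hT : 0 < T) :
    ∃ C : ℝ, 0 < C ∧ ∀ s t : ℝ, 0 ≤ s → s ≤ t → t ≤ T → ∀ x ∈ Set.Icc (0 : ℝ) L,
      (∫ r in Set.Ioc (0 : ℝ) s, ∫ y in Set.Ioc (0 : ℝ) L,
          (greenNeumann L (t - r) x y - greenNeumann L (s - r) x y) ^ 2)
        + (∫ r in Set.Ioc s t, ∫ y in Set.Ioc (0 : ℝ) L, (greenNeumann L (t - r) x y) ^ 2)
        ≤ C * Real.sqrt (t - s) := by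
  refine ⟨2 * (L⁻¹ * (4 * Real.sqrt T + 8 * L / π)), by positivity, ?_⟩
  intro s t hs hst htT x _
  rcases hst.eq_or_lt with rfl | hlt
  · simp
  obtain ⟨S, hS, hsum⟩ := exists_hasSum_majorant_le (T := T) hL (sub_pos.mpr hlt) (by linarith)
  have hsum' := hsum.mul_left L⁻¹
  have h1 : (∫ r in Set.Ioc (0 : ℝ) s, ∫ y in Set.Ioc (0 : ℝ) L,
      (greenNeumann L (t - r) x y - greenNeumann L (s - r) x y) ^ 2) ≤ L⁻¹ * S := by
    refine setIntegral_le_of_hasSum (fun k ↦ by fun_prop) (fun k r ↦ by positivity)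
      (fun r hr ↦ hasSum_integral_greenNeumann_sub_sq hL (by linarith) (by linarith) x)
      (fun k ↦ ?_) hsum'
    have hb := integral_exp_sub_sq_le (neumannEigenvalue_nonneg L k) hs hst
    rw [integral_const_mul]
    exact const_mul_le_majorant hL (by linarith) k x hb.1 hb.2
      (integral_nonneg fun r ↦ sq_nonneg _)
  have h2 : (∫ r in Set.Ioc s t, ∫ y in Set.Ioc (0 : ℝ) L, (greenNeumann L (t - r) x y) ^ 2)
      ≤ L⁻¹ * S := by
    refine setIntegral_le_of_hasSum (fun k ↦ by fun_prop) (fun k r ↦ by positivity)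
      (fun r hr ↦ hasSum_integral_greenNeumann_sq hL (by linarith) x) (fun k ↦ ?_) hsum'
    rw [integral_const_mul]
    exact const_mul_le_majorant hL (by linarith) k x
      (integral_exp_sq_le (neumannEigenvalue_nonneg L k) hst) (mul_integral_exp_sq_le hst)
      (integral_nonneg fun r ↦ sq_nonneg _)
  have h3 := mul_le_mul_of_nonneg_left hS (inv_pos.mpr hL).le
  linarith
end
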